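/- arXiv:1704.03167 — 2 statements merged into one kernel-verified Lean document; each statement's English description precedes it below -/
import Mathlib

section
/- Let (V,E) be a hypergraph whose hyperedges all have size at most d, let k ∈ ℕ, and let ℓ satisfy 1 < ℓ ≤ d. Assume that every subset of V with exactly ℓ elements has at most k^(d−ℓ) extensions in E. If v₁,…,v_{ℓ−1} are pairwise distinct vertices such that there is a hitting set H of (V,E) with |H| ≤ k and H ∩ {v₁,…,v_{ℓ−1}} = ∅, then the set {v₁,…,v_{ℓ−1}} has at most k^(d−(ℓ−1)) extensions in E. -/
/-- Generalized Buss kernelization step for `d`-hitting set (Lemma 8 of the paper).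
If every `ℓ`-element subset of the vertices has at most `k^(d-ℓ)` extensions among the
hyperedges, and `S` is an `(ℓ-1)`-element set of vertices avoided by some hitting set of
size at most `k`, then `S` has at most `k^(d-(ℓ-1))` extensions among the hyperedges. -/
theorem hittingSet_extensions_bound {α : Type*} [DecidableEq α]
    (V : Finset α) (E : Finset (Finset α)) (d k ℓ : ℕ)
    (hedge : ∀ e ∈ E, e ⊆ V ∧ e.Nonempty ∧ e.card ≤ d)
    (hℓ : 1 < ℓ) (hℓd : ℓ ≤ d)
    (hext : ∀ S : Finset α, S ⊆ V → S.card = ℓ →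
      (E.filter fun e => S ⊆ e).card ≤ k ^ (d - ℓ))
    (S : Finset α) (hSV : S ⊆ V) (hScard : S.card = ℓ - 1)
    (H : Finset α) (hHV : H ⊆ V)
    (hhit : ∀ e ∈ E, (H ∩ e).Nonempty)
    (hHcard : H.card ≤ k) (hdisj : H ∩ S = ∅) :
    (E.filter fun e => S ⊆ e).card ≤ k ^ (d - (ℓ - 1)) := by
  have hcover : (E.filter fun e => S ⊆ e) ⊆
      H.biUnion fun h => E.filter fun e => insert h S ⊆ e := by
    intro e he
    obtain ⟨heE, hSe⟩ := Finset.mem_filter.mp he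
    obtain ⟨h, hh⟩ := hhit e heE
    obtain ⟨hH, hhe⟩ := Finset.mem_inter.mp hh
    exact Finset.mem_biUnion.mpr
      ⟨h, hH, Finset.mem_filter.mpr ⟨heE, Finset.insert_subset hhe hSe⟩⟩
  have hbound : ∀ h ∈ H, (E.filter fun e => insert h S ⊆ e).card ≤ k ^ (d - ℓ) := by
    intro h hH
    have hS : h ∉ S :=
      Finset.disjoint_left.mp (Finset.disjoint_iff_inter_eq_empty.mpr hdisj) hH
    refine hext _ (Finset.insert_subset (hHV hH) hSV) ?_
    rw [Finset.card_insert_of_notMem hS]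
    omega
  calc (E.filter fun e => S ⊆ e).card
      ≤ (H.biUnion fun h => E.filter fun e => insert h S ⊆ e).card :=
        Finset.card_le_card hcover
    _ ≤ H.card * k ^ (d - ℓ) := Finset.card_biUnion_le_card_mul _ _ _ hbound
    _ ≤ k * k ^ (d - ℓ) := Nat.mul_le_mul_right _ hHcard
    _ = k ^ (d - (ℓ - 1)) := by
        rw [← pow_succ']
        congr 1
        omega
end

section
/- Let (V,E) be a hypergraph whose hyperedges all have size at most d, let k ∈ ℕ, and let ℓ satisfy 1 < ℓ ≤ d. Assume that every subset of V with exactly ℓ elements has at most k^(d−ℓ) extensions in E. Let S ⊆ V with |S| = ℓ−1 be a set that has more than k^(d−(ℓ−1)) extensions in E, and define E'' := (E \ {e ∈ E : S ⊆ e}) ∪ {S}. Then for every H ⊆ V with |H| ≤ k: H is a hitting set of (V,E) if and only if H is a hitting set of (V,E''). -/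
/-- Replacing all extensions of a "heavy" `(ℓ-1)`-element set `S` by the hyperedge `S`
itself preserves the hitting sets of size at most `k`. -/
theorem hittingSet_replace_heavy_set {α : Type*} [DecidableEq α]
    (V : Finset α) (E : Finset (Finset α)) (d k ℓ : ℕ)
    (hedge : ∀ e ∈ E, e ⊆ V ∧ e.Nonempty ∧ e.card ≤ d)
    (hℓ : 1 < ℓ) (hℓd : ℓ ≤ d)
    (hext : ∀ S : Finset α, S ⊆ V → S.card = ℓ →
      (E.filter fun e => S ⊆ e).card ≤ k ^ (d - ℓ))
    (S : Finset α) (hSV : S ⊆ V) (hScard : S.card = ℓ - 1)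
    (hheavy : k ^ (d - (ℓ - 1)) < (E.filter fun e => S ⊆ e).card) :
    ∀ H : Finset α, H ⊆ V → H.card ≤ k →
      ((∀ e ∈ E, (H ∩ e).Nonempty) ↔
        (∀ e ∈ (E.filter fun e => ¬ S ⊆ e) ∪ {S}, (H ∩ e).Nonempty)) := by
  intro H hHV hHk
  constructor
  · intro hH e he
    rcases Finset.mem_union.1 he with he | he
    · exact hH e (Finset.mem_filter.1 he).1
    · obtain rfl := Finset.mem_singleton.1 he
      by_contra hne
      have hdisj : ∀ v ∈ H, v ∉ e := fun v hv hve =>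
        hne ⟨v, Finset.mem_inter.2 ⟨hv, hve⟩⟩
      have hsub : (E.filter fun f => e ⊆ f) ⊆
          H.biUnion fun v => E.filter fun f => insert v e ⊆ f := by
        intro f hf
        obtain ⟨hfE, hef⟩ := Finset.mem_filter.1 hf
        obtain ⟨v, hv⟩ := hH f hfE
        obtain ⟨hvH, hvf⟩ := Finset.mem_inter.1 hv
        exact Finset.mem_biUnion.2
          ⟨v, hvH, Finset.mem_filter.2 ⟨hfE, Finset.insert_subset hvf hef⟩⟩
      have hbound : (E.filter fun f => e ⊆ f).card ≤ H.card * k ^ (d - ℓ) := by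
        refine (Finset.card_le_card hsub).trans (Finset.card_biUnion_le_card_mul _ _ _ ?_)
        intro v hv
        refine hext _ (Finset.insert_subset (hHV hv) hSV) ?_
        rw [Finset.card_insert_of_notMem (hdisj v hv)]
        omega
      have hpow : k ^ (d - (ℓ - 1)) = k * k ^ (d - ℓ) := by
        rw [← pow_succ']
        congr 1
        omega
      have := Nat.mul_le_mul_right (k ^ (d - ℓ)) hHk
      omega
  · intro hH e he
    by_cases hSe : S ⊆ e
    · exact (hH S (by simp)).mono (Finset.inter_subset_inter_left hSe)
    · exact hH e (Finset.mem_union_left _ (Finset.mem_filter.2 ⟨he, hSe⟩))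
end
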